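/- Let λ > 0, δ ∈ (0,1), and let n ≥ 2 be even. Draw S = ((x₁,y₁),…,(xₙ,yₙ)) i.i.d. from D and let μ̂ be any minimizer of (λ/2)‖μ‖₂² + R̂_S(μ) over {μ ∈ ℝᵖ : μ ≥ 0 coordinatewise}. Then with probability at least 1 − δ over the draw of S, R(μ̂) ≤ R̂_S(μ̂) + 4‖κ‖₂ √(1/(λ n)) + (1 + ‖κ‖₂ √(2/λ)) √(2 log(1/δ) / n). -/

import Mathlib

open MeasureTheory Finset

noncomputable section

/-- The ±1 real value of a Boolean label: `true ↦ 1`, `false ↦ -1`.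
We encode the label space {−1, 1} by `Bool`. -/
def sgn (b : Bool) : ℝ := if b then 1 else -1

/-- The Euclidean (L2) norm on ℝᵖ. -/
def l2norm {p : ℕ} (μ : Fin p → ℝ) : ℝ := Real.sqrt (∑ i, μ i ^ 2)

/-- The L1 norm on ℝᵖ. -/
def l1norm {p : ℕ} (μ : Fin p → ℝ) : ℝ := ∑ i, |μ i|

/-- The L∞ (supremum) norm on ℝᵖ. -/
def linfnorm {p : ℕ} (μ : Fin p → ℝ) : ℝ := ⨆ i, |μ i|

/-- The standard inner product on ℝᵖ. -/
def ip {p : ℕ} (μ v : Fin p → ℝ) : ℝ := ∑ i, μ i * v i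

/-- The K-space feature map `z(x,x') = (K₁(x,x'),…,K_p(x,x'))`. -/
def zmap {X : Type*} {p : ℕ} (K : Fin p → X → X → ℝ) (x x' : X) : Fin p → ℝ :=
  fun i => K i x x'

/-- The pairwise hinge loss `ℓ(μ, (x,y), (x',y')) = max(0, 1 − y y' ⟨μ, z(x,x')⟩)`. -/
def hinge {X : Type*} {p : ℕ} (K : Fin p → X → X → ℝ) (μ : Fin p → ℝ)
    (w w' : X × Bool) : ℝ :=
  max 0 (1 - sgn w.2 * sgn w'.2 * ip μ (zmap K w.1 w'.1))

/-- The empirical risk `R̂_S(μ) = (2/(n(n−1))) Σ_{1≤i<j≤n} ℓ(μ, (xᵢ,yᵢ), (xⱼ,yⱼ))`. -/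
def empRisk {X : Type*} {p n : ℕ} (K : Fin p → X → X → ℝ)
    (S : Fin n → X × Bool) (μ : Fin p → ℝ) : ℝ :=
  (2 / ((n : ℝ) * ((n : ℝ) - 1))) *
    ∑ i : Fin n, ∑ j : Fin n, if i < j then hinge K μ (S i) (S j) else 0

/-- The true risk `R(μ) = E_{((x,y),(x',y')) ~ D×D}[max(0, 1 − y y' ⟨μ, z(x,x')⟩)]`. -/
def trueRisk {X : Type*} [MeasurableSpace X] {p : ℕ} (K : Fin p → X → X → ℝ)
    (D : Measure (X × Bool)) (μ : Fin p → ℝ) : ℝ :=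
  ∫ w, hinge K μ w.1 w.2 ∂(D.prod D)

/-- Expectation over m i.i.d. Rademacher random variables (uniform on {−1,+1}),
encoded by Booleans mapped to ±1 via `sgn`. -/
def radE {m : ℕ} (f : (Fin m → Bool) → ℝ) : ℝ :=
  (∑ ε : Fin m → Bool, f ε) / 2 ^ m

lemma integrable_of_measurable_of_abs_le {Ω : Type*} [MeasurableSpace Ω] {P : Measure Ω}
    [IsFiniteMeasure P] {f : Ω → ℝ} (hf : Measurable f) {C : ℝ} (h : ∀ x, |f x| ≤ C) :
    Integrable f P :=
  Integrable.of_bound hf.aestronglyMeasurable C (ae_of_all _ h)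

lemma abs_integral_le_of_abs_le {Ω : Type*} [MeasurableSpace Ω] {P : Measure Ω}
    [IsProbabilityMeasure P] {f : Ω → ℝ} {C : ℝ} (h : ∀ x, |f x| ≤ C) : |∫ x, f x ∂P| ≤ C := by
  simpa using norm_integral_le_of_norm_le_const (μ := P) (f := f) (C := C) (ae_of_all _ h)

lemma integral_comp_of_measurePreserving {Ω Ω' : Type*} [MeasurableSpace Ω] [MeasurableSpace Ω']
    {P : Measure Ω} {P' : Measure Ω'} {φ : Ω → Ω'} (hφ : MeasurePreserving φ P P')
    {f : Ω' → ℝ} (hf : Measurable f) : ∫ x, f (φ x) ∂P = ∫ y, f y ∂P' := by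
  rw [← hφ.map_eq, integral_map hφ.aemeasurable hf.aestronglyMeasurable]

lemma measurePreserving_cons {Ω : Type*} [MeasurableSpace Ω] (P : Measure Ω)
    [IsProbabilityMeasure P] (m : ℕ) :
    MeasurePreserving (fun q : Ω × (Fin m → Ω) => (Fin.cons q.1 q.2 : Fin (m + 1) → Ω))
      (P.prod (Measure.pi fun _ => P)) (Measure.pi fun _ => P) := by
  have h := (measurePreserving_piFinSuccAbove (fun _ : Fin (m + 1) => P) 0).symm
  convert h using 1
  ext q
  simp [MeasurableEquiv.piFinSuccAbove_symm_apply, Fin.insertNthEquiv, Fin.insertNth_zero']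

/-- Hoeffding's lemma for a measurable function of oscillation at most `c`. -/
lemma integral_exp_le_of_abs_sub_le {Ω : Type*} [MeasurableSpace Ω] (P : Measure Ω)
    [IsProbabilityMeasure P] {c : ℝ} (s : ℝ) {h : Ω → ℝ} (hm : Measurable h)
    (hc : ∀ x y, |h x - h y| ≤ c) :
    ∫ x, Real.exp (s * (h x - ∫ y, h y ∂P)) ∂P ≤ Real.exp (s ^ 2 * c ^ 2 / 8) := by
  obtain ⟨x₀⟩ : Nonempty Ω := P.nonempty_of_neZero
  have hbdd : BddBelow (Set.range h) := by
    refine ⟨h x₀ - c, ?_⟩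
    rintro _ ⟨x, rfl⟩
    linarith [(abs_le.1 (hc x₀ x)).2]
  have hmem : ∀ x, h x ∈ Set.Icc (⨅ y, h y) ((⨅ y, h y) + c) := by
    intro x
    refine ⟨ciInf_le hbdd x, ?_⟩
    have hle : h x - c ≤ ⨅ y, h y := by
      have : Nonempty Ω := ⟨x₀⟩
      exact le_ciInf fun y => by linarith [(abs_le.1 (hc x y)).2]
    linarith
  have key := (ProbabilityTheory.hasSubgaussianMGF_of_mem_Icc (μ := P) hm.aemeasurable
    (ae_of_all _ hmem)).mgf_le s
  refine key.trans (Real.exp_le_exp.2 (le_of_eq ?_))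
  simp only [add_sub_cancel_left, NNReal.coe_pow, NNReal.coe_div, coe_nnnorm, Real.norm_eq_abs,
    NNReal.coe_ofNat, div_pow, sq_abs]
  ring

/-- Moment generating function form of McDiarmid's bounded differences inequality. -/
theorem integral_exp_le_of_bounded_differences {Ω : Type*} [MeasurableSpace Ω] (P : Measure Ω)
    [IsProbabilityMeasure P] {c C : ℝ} (s : ℝ) (m : ℕ) (f : (Fin m → Ω) → ℝ) (hf : Measurable f)
    (hC : ∀ w, |f w| ≤ C) (hc : ∀ w k z, |f (Function.update w k z) - f w| ≤ c) :
    ∫ w, Real.exp (s * (f w - ∫ v, f v ∂(Measure.pi fun _ => P))) ∂(Measure.pi fun _ => P) ≤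
      Real.exp (m * (s ^ 2 * c ^ 2 / 8)) := by
  induction m with
  | zero =>
    have : ∀ w, f w = f default := fun w => congrArg f (Subsingleton.elim _ _)
    simp [this]
  | succ m ih =>
    set Q : Measure (Fin m → Ω) := Measure.pi fun _ => P with hQ
    have hcons := measurePreserving_cons P m
    have hfc : Measurable fun q : Ω × (Fin m → Ω) => f (Fin.cons q.1 q.2) :=
      hf.comp hcons.measurable
    set h : Ω → ℝ := fun z => ∫ w, f (Fin.cons z w) ∂Q with hh
    have hfz : ∀ z, Measurable fun w : Fin m → Ω => f (Fin.cons z w) := fun z =>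
      hfc.comp measurable_prodMk_left
    have hfzi : ∀ z, Integrable (fun w : Fin m → Ω => f (Fin.cons z w)) Q := fun z =>
      integrable_of_measurable_of_abs_le (hfz z) fun w => hC _
    have hhm : Measurable h := hfc.stronglyMeasurable.integral_prod_right.measurable
    have hhC : ∀ z, |h z| ≤ C := fun z => abs_integral_le_of_abs_le fun w => hC _
    have hhc : ∀ x y, |h x - h y| ≤ c := fun x y => by
      rw [hh]
      simp only
      rw [← integral_sub (hfzi x) (hfzi y)]
      refine abs_integral_le_of_abs_le fun w => ?_
      have := hc (Fin.cons y w) 0 x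
      rwa [Fin.update_cons_zero] at this
    have hE : ∫ v, f v ∂(Measure.pi fun _ => P) = ∫ z, h z ∂P := by
      rw [← integral_comp_of_measurePreserving hcons hf, integral_prod]
      exact integrable_of_measurable_of_abs_le hfc fun q => hC _
    rw [hE]
    set e := ∫ z, h z ∂P with he
    have heC : |e| ≤ C := abs_integral_le_of_abs_le hhC
    have hexpm : Measurable fun w : Fin (m + 1) → Ω => Real.exp (s * (f w - e)) := by fun_prop
    have hbound : ∀ a b : ℝ, |a| ≤ C → |b| ≤ C →
        |Real.exp (s * (a - b))| ≤ Real.exp (|s| * (C + C)) := fun a b ha hb => by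
      rw [Real.abs_exp]
      refine Real.exp_le_exp.2 ((le_abs_self _).trans ?_)
      rw [abs_mul]
      exact mul_le_mul_of_nonneg_left ((abs_sub a b).trans (add_le_add ha hb)) (abs_nonneg s)
    rw [← integral_comp_of_measurePreserving hcons hexpm, integral_prod]
    · have hinner : ∀ z, ∫ w, Real.exp (s * (f (Fin.cons z w) - e)) ∂Q ≤
          Real.exp (m * (s ^ 2 * c ^ 2 / 8)) * Real.exp (s * (h z - e)) := fun z => by
        have h1 : ∀ w : Fin m → Ω, Real.exp (s * (f (Fin.cons z w) - e)) =
            Real.exp (s * (f (Fin.cons z w) - h z)) * Real.exp (s * (h z - e)) := fun w => by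
          rw [← Real.exp_add]; ring_nf
        simp_rw [h1]
        rw [integral_mul_const]
        refine mul_le_mul_of_nonneg_right ?_ (Real.exp_pos _).le
        refine ih (fun w => f (Fin.cons z w)) (hfz z) (fun w => hC _) fun w k x => ?_
        have := hc (Fin.cons z w) k.succ x
        rwa [← Fin.cons_update] at this
      have hm1 : Measurable fun z => Real.exp (s * (h z - e)) := by fun_prop
      calc ∫ z, ∫ w, Real.exp (s * (f (Fin.cons z w) - e)) ∂Q ∂P
          ≤ ∫ z, Real.exp (m * (s ^ 2 * c ^ 2 / 8)) * Real.exp (s * (h z - e)) ∂P := by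
            refine integral_mono ?_ ?_ hinner
            · exact (integrable_of_measurable_of_abs_le (hexpm.comp hcons.measurable)
                fun q => hbound _ _ (hC _) heC).integral_prod_left
            · exact (integrable_of_measurable_of_abs_le hm1
                fun z => hbound _ _ (hhC z) heC).const_mul _
        _ = Real.exp (m * (s ^ 2 * c ^ 2 / 8)) * ∫ z, Real.exp (s * (h z - e)) ∂P :=
            integral_const_mul _ _
        _ ≤ Real.exp (m * (s ^ 2 * c ^ 2 / 8)) * Real.exp (s ^ 2 * c ^ 2 / 8) :=
            mul_le_mul_of_nonneg_left (integral_exp_le_of_abs_sub_le P s hhm hhc)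
              (Real.exp_pos _).le
        _ = Real.exp ((m + 1 : ℕ) * (s ^ 2 * c ^ 2 / 8)) := by
            rw [← Real.exp_add]; push_cast; ring_nf
    · exact integrable_of_measurable_of_abs_le (hexpm.comp hcons.measurable)
        fun q => hbound _ _ (hC _) heC

lemma abs_sgn (b : Bool) : |sgn b| = 1 := by cases b <;> simp [sgn]

lemma sgn_not (b : Bool) : sgn (!b) = -sgn b := by cases b <;> simp [sgn]

lemma sum_pi_bool_succ {m : ℕ} (F : (Fin (m + 1) → Bool) → ℝ) :
    ∑ ε, F ε = ∑ ε : Fin m → Bool, (F (Fin.cons true ε) + F (Fin.cons false ε)) := by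
  rw [← (Fin.consEquiv fun _ => Bool).sum_comp, Fintype.sum_prod_type, Fintype.sum_bool,
    Finset.sum_add_distrib]
  rfl

lemma sum_radSum_sq {m : ℕ} (g : ℝ) (v : Fin m → ℝ) :
    ∑ ε : Fin m → Bool, (g + ∑ k, sgn (ε k) * v k) ^ 2 = 2 ^ m * (g ^ 2 + ∑ k, v k ^ 2) := by
  induction m generalizing g with
  | zero => simp
  | succ m ih =>
    rw [sum_pi_bool_succ, Finset.sum_add_distrib]
    simp only [Fin.sum_univ_succ, Fin.cons_zero, Fin.cons_succ, ← add_assoc, ih]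
    simp only [sgn]
    simp
    ring

lemma abs_radSum_le {m : ℕ} {C : ℝ} (ε : Fin m → Bool) {v : Fin m → ℝ} (hv : ∀ k, |v k| ≤ C) :
    |∑ k, sgn (ε k) * v k| ≤ m * C := by
  refine (Finset.abs_sum_le_sum_abs _ _).trans ?_
  simp only [abs_mul, abs_sgn, one_mul]
  simpa using Finset.sum_le_sum fun k (_ : k ∈ Finset.univ) => hv k

lemma bddAbove_range_of_abs_le {T : Type*} {f : T → ℝ} {C : ℝ} (h : ∀ t, |f t| ≤ C) :
    BddAbove (Set.range f) :=
  ⟨C, by rintro _ ⟨t, rfl⟩; exact (abs_le.1 (h t)).2⟩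

lemma abs_iSup_le_of_abs_le {T : Type*} [Nonempty T] {f : T → ℝ} {C : ℝ} (h : ∀ t, |f t| ≤ C) :
    |⨆ t, f t| ≤ C := by
  obtain ⟨t₀⟩ := ‹Nonempty T›
  have : Nonempty T := ⟨t₀⟩
  refine abs_le.2 ⟨?_, ciSup_le fun t => (abs_le.1 (h t)).2⟩
  exact (abs_le.1 (h t₀)).1.trans (le_ciSup (bddAbove_range_of_abs_le h) t₀)

lemma iSup_add_iSup_le_of_contraction {T : Type*} [Nonempty T] {u a b : T → ℝ} {C : ℝ}
    (hp : ∀ t, |u t + a t| ≤ C) (hm : ∀ t, |u t - a t| ≤ C)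
    (h : ∀ s t, b s - b t ≤ |a s - a t|) :
    (⨆ t, (u t + b t)) + (⨆ t, (u t - b t)) ≤ (⨆ t, (u t + a t)) + (⨆ t, (u t - a t)) := by
  have hp' : ∀ t, u t + a t ≤ ⨆ t, (u t + a t) := le_ciSup (bddAbove_range_of_abs_le hp)
  have hm' : ∀ t, u t - a t ≤ ⨆ t, (u t - a t) := le_ciSup (bddAbove_range_of_abs_le hm)
  refine ciSup_add_ciSup_le fun s t => ?_
  have h1 := h s t
  rcases abs_cases (a s - a t) with h2 | h2
  · linarith [hp' s, hm' t]
  · linarith [hp' t, hm' s]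

/-- The Ledoux–Talagrand contraction inequality for Rademacher sums, with an offset `g`. -/
theorem sum_iSup_le_of_contraction {T : Type*} [Nonempty T] {m : ℕ} {C C' : ℝ} (g : T → ℝ)
    (a b : Fin m → T → ℝ) (hg : ∀ t, |g t| ≤ C') (ha : ∀ k t, |a k t| ≤ C)
    (hb : ∀ k t, |b k t| ≤ C) (h : ∀ k s t, b k s - b k t ≤ |a k s - a k t|) :
    ∑ ε : Fin m → Bool, ⨆ t, (g t + ∑ k, sgn (ε k) * b k t) ≤
      ∑ ε : Fin m → Bool, ⨆ t, (g t + ∑ k, sgn (ε k) * a k t) := by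
  induction m generalizing g C' with
  | zero => simp
  | succ m ih =>
    have hshift : ∀ c : Bool, ∑ ε : Fin m → Bool,
          ⨆ t, ((g t + sgn c * b 0 t) + ∑ k : Fin m, sgn (ε k) * b k.succ t) ≤
        ∑ ε : Fin m → Bool,
          ⨆ t, ((g t + sgn c * b 0 t) + ∑ k : Fin m, sgn (ε k) * a k.succ t) := fun c => by
      refine ih (C' := C' + C) _ (fun k => a k.succ) (fun k => b k.succ) (fun t => ?_)
        (fun k => ha k.succ) (fun k => hb k.succ) fun k => h k.succ
      refine (abs_add_le _ _).trans (add_le_add (hg t) ?_)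
      rw [abs_mul, abs_sgn, one_mul]
      exact hb 0 t
    rw [sum_pi_bool_succ, sum_pi_bool_succ, Finset.sum_add_distrib]
    simp only [Fin.sum_univ_succ, Fin.cons_zero, Fin.cons_succ, ← add_assoc]
    refine (add_le_add (hshift true) (hshift false)).trans ?_
    rw [← Finset.sum_add_distrib]
    refine Finset.sum_le_sum fun ε _ => ?_
    have hu : ∀ t, |g t + ∑ k : Fin m, sgn (ε k) * a k.succ t| ≤ C' + m * C := fun t =>
      (abs_add_le _ _).trans (add_le_add (hg t) (abs_radSum_le ε fun k => ha k.succ t))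
    have key := iSup_add_iSup_le_of_contraction (C := C' + m * C + C)
      (u := fun t => g t + ∑ k : Fin m, sgn (ε k) * a k.succ t) (a := a 0) (b := b 0)
      (fun t => (abs_add_le _ _).trans (add_le_add (hu t) (ha 0 t)))
      (fun t => (abs_sub _ _).trans (add_le_add (hu t) (ha 0 t))) (h 0)
    simpa [sgn, add_right_comm, sub_eq_add_neg] using key

/-- The largest deviation, over a family of losses `ℓ`, of the sum of the losses on the sample `w`
below its expectation under `P`. -/
def supDeviation {T Z : Type*} [MeasurableSpace Z] (P : Measure Z) (ℓ : T → Z → ℝ) {m : ℕ}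
    (w : Fin m → Z) : ℝ :=
  ⨆ t, ∑ k, (∫ z, ℓ t z ∂P - ℓ t (w k))

lemma abs_sum_le_of_abs_le {m : ℕ} {C : ℝ} {v : Fin m → ℝ} (hv : ∀ k, |v k| ≤ C) :
    |∑ k, v k| ≤ m * C := by
  refine (Finset.abs_sum_le_sum_abs _ _).trans ?_
  simpa using Finset.sum_le_sum fun k (_ : k ∈ Finset.univ) => hv k

lemma measurable_supDeviation {T Z : Type*} [Countable T] [MeasurableSpace Z] (P : Measure Z)
    {ℓ : T → Z → ℝ} {m : ℕ} (hm : ∀ t, Measurable (ℓ t)) :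
    Measurable (supDeviation P ℓ : (Fin m → Z) → ℝ) := by
  unfold supDeviation
  refine Measurable.iSup fun t => ?_
  have := hm t
  fun_prop

lemma abs_sum_integral_sub_le {T Z : Type*} [MeasurableSpace Z] (P : Measure Z)
    [IsProbabilityMeasure P] {ℓ : T → Z → ℝ} {m : ℕ} {M : ℝ}
    (hM : ∀ t z, |ℓ t z| ≤ M) (w : Fin m → Z) (t : T) :
    |∑ k, (∫ z, ℓ t z ∂P - ℓ t (w k))| ≤ m * (M + M) :=
  abs_sum_le_of_abs_le fun k =>
    (abs_sub _ _).trans (add_le_add (abs_integral_le_of_abs_le (hM t)) (hM t (w k)))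

lemma abs_supDeviation_le {T Z : Type*} [Nonempty T] [MeasurableSpace Z] (P : Measure Z)
    [IsProbabilityMeasure P] {ℓ : T → Z → ℝ} {m : ℕ} {M : ℝ}
    (hM : ∀ t z, |ℓ t z| ≤ M) (w : Fin m → Z) :
    |supDeviation P ℓ w| ≤ m * (M + M) :=
  abs_iSup_le_of_abs_le fun t => abs_sum_integral_sub_le P hM w t

lemma supDeviation_update_le {T Z : Type*} [Nonempty T] [MeasurableSpace Z] (P : Measure Z)
    [IsProbabilityMeasure P] {ℓ : T → Z → ℝ} {m : ℕ} {M : ℝ}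
    (h0 : ∀ t z, 0 ≤ ℓ t z) (hM : ∀ t z, ℓ t z ≤ M) (w : Fin m → Z)
    (k : Fin m) (z : Z) : supDeviation P ℓ (Function.update w k z) ≤ supDeviation P ℓ w + M := by
  have hM' : ∀ t z, |ℓ t z| ≤ M := fun t z => by rw [abs_of_nonneg (h0 t z)]; exact hM t z
  refine ciSup_le fun t => ?_
  have h1 : ∑ j, (∫ z, ℓ t z ∂P - ℓ t (w j)) ≤ supDeviation P ℓ w :=
    le_ciSup (bddAbove_range_of_abs_le fun t => abs_sum_integral_sub_le P hM' w t) t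
  have h2 : ∑ j, (∫ z, ℓ t z ∂P - ℓ t (Function.update w k z j)) -
      ∑ j, (∫ z, ℓ t z ∂P - ℓ t (w j)) = ℓ t (w k) - ℓ t z := by
    rw [← Finset.sum_sub_distrib, Finset.sum_eq_single k]
    · simp
    · intro j _ hj
      simp [Function.update_of_ne hj]
    · simp
  linarith [hM t (w k), h0 t z]

lemma abs_supDeviation_update_sub_le {T Z : Type*} [Nonempty T] [MeasurableSpace Z] (P : Measure Z)
    [IsProbabilityMeasure P] {ℓ : T → Z → ℝ} {m : ℕ} {M : ℝ}
    (h0 : ∀ t z, 0 ≤ ℓ t z) (hM : ∀ t z, ℓ t z ≤ M)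
    (w : Fin m → Z) (k : Fin m) (z : Z) :
    |supDeviation P ℓ (Function.update w k z) - supDeviation P ℓ w| ≤ M := by
  have h1 := supDeviation_update_le P h0 hM w k z
  have h2 := supDeviation_update_le P h0 hM (Function.update w k z) k (w k)
  rw [Function.update_idem, Function.update_eq_self] at h2
  exact abs_le.2 ⟨by linarith, by linarith⟩

lemma sum_iSup_radSum_sub_le {T Z : Type*} [Nonempty T] {ℓ : T → Z → ℝ} {m : ℕ} {M A : ℝ}
    (hM : ∀ t z, |ℓ t z| ≤ M)
    (hA : ∀ w : Fin m → Z, ∑ ε : Fin m → Bool, ⨆ t, ∑ k, sgn (ε k) * ℓ t (w k) ≤ 2 ^ m * A)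
    (v : Fin m → Z × Z) :
    ∑ ε : Fin m → Bool, ⨆ t, ∑ k, sgn (ε k) * (ℓ t (v k).2 - ℓ t (v k).1) ≤
      2 ^ m * (2 * A) := by
  have hbdd : ∀ (ε : Fin m → Bool) (w : Fin m → Z),
      BddAbove (Set.range fun t => ∑ k, sgn (ε k) * ℓ t (w k)) := fun ε w =>
    bddAbove_range_of_abs_le fun t => abs_radSum_le ε fun k => hM t (w k)
  calc ∑ ε : Fin m → Bool, ⨆ t, ∑ k, sgn (ε k) * (ℓ t (v k).2 - ℓ t (v k).1)
      ≤ ∑ ε : Fin m → Bool, ((⨆ t, ∑ k, sgn (ε k) * ℓ t (v k).2) +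
          ⨆ t, ∑ k, sgn (!ε k) * ℓ t (v k).1) := by
        refine Finset.sum_le_sum fun ε _ => ciSup_le fun t => ?_
        have h1 := le_ciSup (hbdd ε fun k => (v k).2) t
        have h2 := le_ciSup (hbdd (fun k => !ε k) fun k => (v k).1) t
        refine le_trans (le_of_eq ?_) (add_le_add h1 h2)
        rw [← Finset.sum_add_distrib]
        refine Finset.sum_congr rfl fun k _ => ?_
        rw [sgn_not]
        ring
    _ = (∑ ε : Fin m → Bool, ⨆ t, ∑ k, sgn (ε k) * ℓ t (v k).2) +
          ∑ ε : Fin m → Bool, ⨆ t, ∑ k, sgn (ε k) * ℓ t (v k).1 := by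
        rw [Finset.sum_add_distrib, ← (Equiv.piCongrRight fun _ : Fin m => Equiv.boolNot).sum_comp
          fun ε => ⨆ t, ∑ k, sgn (ε k) * ℓ t (v k).1]
        rfl
    _ ≤ 2 ^ m * (2 * A) := by
        linarith [hA fun k => (v k).2, hA fun k => (v k).1]

/-- Symmetrization: the expected deviation is at most twice the Rademacher average. -/
theorem integral_supDeviation_le {T Z : Type*} [Countable T] [Nonempty T] [MeasurableSpace Z]
    (P : Measure Z) [IsProbabilityMeasure P] {ℓ : T → Z → ℝ} {m : ℕ} {M A : ℝ}
    (hm : ∀ t, Measurable (ℓ t)) (hM : ∀ t z, |ℓ t z| ≤ M)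
    (hA : ∀ w : Fin m → Z, ∑ ε : Fin m → Bool, ⨆ t, ∑ k, sgn (ε k) * ℓ t (w k) ≤ 2 ^ m * A) :
    ∫ w, supDeviation P ℓ w ∂(Measure.pi fun _ : Fin m => P) ≤ 2 * A := by
  set Q : Measure (Fin m → Z) := Measure.pi fun _ => P with hQ
  set Q2 : Measure (Fin m → Z × Z) := Measure.pi fun _ => P.prod P with hQ2
  set Ψ : (Fin m → Bool) → (Fin m → Z × Z) → ℝ := fun ε v =>
    ⨆ t, ∑ k, sgn (ε k) * (ℓ t (v k).2 - ℓ t (v k).1) with hΨ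
  have hdiff : ∀ t z z', |ℓ t z - ℓ t z'| ≤ M + M := fun t z z' =>
    (abs_sub _ _).trans (add_le_add (hM t z) (hM t z'))
  have hΨm : ∀ ε, Measurable (Ψ ε) := fun ε => Measurable.iSup fun t => by
    have := hm t
    fun_prop
  have hΨM : ∀ ε v, |Ψ ε v| ≤ m * (M + M) := fun ε v =>
    abs_iSup_le_of_abs_le fun t => abs_radSum_le ε fun k => hdiff t _ _
  have hsign : ∀ ε, ∫ v, Ψ ε v ∂Q2 = ∫ v, Ψ (fun _ => true) v ∂Q2 := fun ε => by
    have hmp : MeasurePreserving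
        (fun (v : Fin m → Z × Z) k => (if ε k then id else Prod.swap) (v k)) Q2 Q2 := by
      refine measurePreserving_pi (fun _ => P.prod P) (fun _ => P.prod P)
        (f := fun k => if ε k then id else Prod.swap) fun k => ?_
      cases ε k
      · simpa using Measure.measurePreserving_swap
      · simpa using MeasurePreserving.id _
    rw [← integral_comp_of_measurePreserving hmp (hΨm fun _ => true)]
    congr 1
    ext v
    simp only [hΨ]
    congr 1
    ext t
    refine Finset.sum_congr rfl fun k _ => ?_
    cases ε k <;> simp [sgn]
  have hghost : ∫ w, supDeviation P ℓ w ∂Q ≤ ∫ v, Ψ (fun _ => true) v ∂Q2 := by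
    have hmp := (measurePreserving_arrowProdEquivProdArrow Z Z (Fin m)
      (fun _ => P) (fun _ => P)).symm
    have hmeas : Measurable fun q : (Fin m → Z) × (Fin m → Z) =>
        Ψ (fun _ => true) (fun k => (q.1 k, q.2 k)) :=
      (hΨm _).comp (by fun_prop)
    have hint : Integrable (fun q : (Fin m → Z) × (Fin m → Z) =>
        Ψ (fun _ => true) (fun k => (q.1 k, q.2 k))) (Q.prod Q) :=
      integrable_of_measurable_of_abs_le hmeas fun q => hΨM _ _
    have h1 : ∫ v, Ψ (fun _ => true) v ∂Q2 =
        ∫ w, ∫ w', Ψ (fun _ => true) (fun k => (w k, w' k)) ∂Q ∂Q := by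
      rw [← integral_comp_of_measurePreserving hmp (hΨm _), ← integral_prod _ hint]
      rfl
    rw [h1]
    refine integral_mono (integrable_of_measurable_of_abs_le (measurable_supDeviation P hm)
      fun w => abs_supDeviation_le P hM w) hint.integral_prod_left fun w => ciSup_le fun t => ?_
    have hk : ∀ k : Fin m, Integrable (fun w' : Fin m → Z => ℓ t (w' k) - ℓ t (w k)) Q := fun k =>
      integrable_of_measurable_of_abs_le
        (((hm t).comp (measurable_pi_apply k)).sub_const _) fun w' => hdiff t _ _
    have h2 : ∑ k, (∫ z, ℓ t z ∂P - ℓ t (w k)) =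
        ∫ w', ∑ k, (ℓ t (w' k) - ℓ t (w k)) ∂Q := by
      rw [integral_finsetSum _ fun k _ => hk k]
      refine Finset.sum_congr rfl fun k _ => ?_
      have hkt : Integrable (fun w' : Fin m → Z => ℓ t (w' k)) Q :=
        integrable_of_measurable_of_abs_le ((hm t).comp (measurable_pi_apply k)) fun w' => hM t _
      rw [integral_sub hkt (integrable_const _),
        integral_comp_of_measurePreserving (measurePreserving_eval (fun _ : Fin m => P) k) (hm t)]
      simp
    rw [h2]
    have hwi : Integrable (fun w' : Fin m → Z => Ψ (fun _ => true) fun k => (w k, w' k)) Q :=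
      integrable_of_measurable_of_abs_le ((hΨm _).comp (by fun_prop)) fun w' => hΨM _ _
    refine integral_mono (integrable_finsetSum _ fun k _ => hk k) hwi fun w' => ?_
    have hbdd : ∀ t, |∑ k, sgn true * (ℓ t (w' k) - ℓ t (w k))| ≤ m * (M + M) := fun t =>
      abs_radSum_le (fun _ => true) fun k => hdiff t (w' k) (w k)
    have := le_ciSup (bddAbove_range_of_abs_le hbdd) t
    simpa [hΨ, sgn] using this
  refine hghost.trans ?_
  have hΨi : ∀ ε, Integrable (Ψ ε) Q2 := fun ε =>
    integrable_of_measurable_of_abs_le (hΨm ε) (hΨM ε)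
  have hsum : 2 ^ m * ∫ v, Ψ (fun _ => true) v ∂Q2 = ∫ v, ∑ ε, Ψ ε v ∂Q2 := by
    rw [integral_finsetSum _ fun ε _ => hΨi ε]
    simp [hsign]
  have hle : ∫ v, ∑ ε, Ψ ε v ∂Q2 ≤ 2 ^ m * (2 * A) := by
    have hmono := integral_mono (integrable_finsetSum Finset.univ fun ε _ => hΨi ε)
      (integrable_const (2 ^ m * (2 * A))) fun v => sum_iSup_radSum_sub_le hM hA v
    simpa using hmono
  rw [← hsum] at hle
  exact le_of_mul_le_mul_left hle (by positivity)

lemma exists_perm_apply_eq {α : Type*} [DecidableEq α] {a b c d : α} (hab : a ≠ b) (hcd : c ≠ d) :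
    ∃ τ : Equiv.Perm α, τ c = a ∧ τ d = b := by
  refine ⟨Equiv.swap (Equiv.swap c a d) b * Equiv.swap c a, ?_, by simp⟩
  have h : a ≠ Equiv.swap c a d := fun h => hcd (by
    rw [← Equiv.swap_apply_left c a] at h
    nth_rewrite 2 [Equiv.swap_apply_left] at h
    exact (Equiv.swap c a).injective h)
  rw [Equiv.Perm.mul_apply, Equiv.swap_apply_left, Equiv.swap_apply_of_ne_of_ne h hab]

/-- Averaging a function of two distinct indices over all permutations. -/
lemma sum_perm_apply_apply {α : Type*} [Fintype α] [DecidableEq α] (f : α → α → ℝ) {a b : α}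
    (hab : a ≠ b) :
    (Fintype.card α : ℝ) * (Fintype.card α - 1) * ∑ σ : Equiv.Perm α, f (σ a) (σ b) =
      Fintype.card (Equiv.Perm α) * ∑ i, ∑ j, if i = j then 0 else f i j := by
  have h1 : ∀ c d, c ≠ d →
      ∑ σ : Equiv.Perm α, f (σ c) (σ d) = ∑ σ : Equiv.Perm α, f (σ a) (σ b) := fun c d hcd => by
    obtain ⟨τ, rfl, rfl⟩ := exists_perm_apply_eq hab hcd
    exact (Equiv.sum_comp (Equiv.mulRight τ) fun σ : Equiv.Perm α => f (σ c) (σ d)).symm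
  have h2 : ∀ σ : Equiv.Perm α, ∑ i, ∑ j, (if i = j then 0 else f (σ i) (σ j)) =
      ∑ i, ∑ j, if i = j then 0 else f i j := fun σ => by
    rw [← Equiv.sum_comp σ fun i => ∑ j, if i = j then 0 else f i j]
    refine Finset.sum_congr rfl fun i _ => ?_
    rw [← Equiv.sum_comp σ fun j => if σ i = j then 0 else f (σ i) j]
    simp
  have h3 : ∑ σ : Equiv.Perm α, ∑ i, ∑ j, (if i = j then 0 else f (σ i) (σ j)) =
      ∑ i : α, ∑ j : α, if i = j then 0 else ∑ σ : Equiv.Perm α, f (σ a) (σ b) := by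
    refine Finset.sum_comm.trans (Finset.sum_congr rfl fun i _ =>
      Finset.sum_comm.trans (Finset.sum_congr rfl fun j _ => ?_))
    split_ifs with hij
    · simp
    · exact h1 i j hij
  simp only [h2, Finset.sum_const, Finset.card_univ, nsmul_eq_mul] at h3
  rw [h3]
  simp only [Finset.sum_ite, Finset.sum_const_zero, zero_add, Finset.sum_const, nsmul_eq_mul,
    ← Finset.sum_mul]
  congr 1
  have h4 : ∀ i : α, ((Finset.univ.filter fun j => ¬ i = j).card : ℝ) = Fintype.card α - 1 :=
    fun i => by
      rw [Finset.filter_not, Finset.filter_eq, if_pos (Finset.mem_univ i),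
        ← Finset.compl_eq_univ_sdiff, Finset.card_compl, Finset.card_singleton,
        Nat.cast_pred (Fintype.card_pos_iff.2 ⟨i⟩)]
  simp only [h4, Finset.sum_const, Finset.card_univ, nsmul_eq_mul]

/-- The sample `S` cut into `m` disjoint pairs by the permutation `σ`, each pair listed in
increasing order of indices. -/
def pairing {W : Type*} {m : ℕ} (σ : Equiv.Perm (Fin (m + m))) (S : Fin (m + m) → W) (k : Fin m) :
    W × W :=
  (S (min (σ (Fin.castAdd m k)) (σ (Fin.natAdd m k))),
    S (max (σ (Fin.castAdd m k)) (σ (Fin.natAdd m k))))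

lemma castAdd_ne_natAdd {m : ℕ} (k l : Fin m) : Fin.castAdd m k ≠ Fin.natAdd m l := fun h => by
  have := congrArg Fin.val h
  simp at this
  omega

lemma measurePreserving_pairing {W : Type*} [MeasurableSpace W] (D : Measure W)
    [IsProbabilityMeasure D] {m : ℕ} (σ : Equiv.Perm (Fin (m + m))) :
    MeasurePreserving (pairing σ : (Fin (m + m) → W) → Fin m → W × W)
      (Measure.pi fun _ => D) (Measure.pi fun _ => D.prod D) := by
  let g : Fin m ⊕ Fin m → Fin (m + m) :=
    Sum.elim (fun k => min (σ (Fin.castAdd m k)) (σ (Fin.natAdd m k)))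
      fun k => max (σ (Fin.castAdd m k)) (σ (Fin.natAdd m k))
  have hcc : ∀ k l : Fin m, σ (Fin.castAdd m k) = σ (Fin.castAdd m l) → k = l := fun k l h =>
    Fin.castAdd_injective _ _ (σ.injective h)
  have hnn : ∀ k l : Fin m, σ (Fin.natAdd m k) = σ (Fin.natAdd m l) → k = l := fun k l h =>
    Fin.natAdd_injective _ _ (σ.injective h)
  have hcn : ∀ k l : Fin m, σ (Fin.castAdd m k) ≠ σ (Fin.natAdd m l) := fun k l h =>
    castAdd_ne_natAdd k l (σ.injective h)
  have hinj : Function.Injective g := by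
    rintro (k | k) (l | l) h <;> simp only [g, Sum.elim_inl, Sum.elim_inr] at h
    all_goals
      rcases le_total (σ (Fin.castAdd m k)) (σ (Fin.natAdd m k)) with h1 | h1 <;>
      rcases le_total (σ (Fin.castAdd m l)) (σ (Fin.natAdd m l)) with h2 | h2 <;>
      simp only [h1, h2, min_eq_left, min_eq_right, max_eq_left, max_eq_right] at h <;>
      grind
  let e : Fin m ⊕ Fin m ≃ Fin (m + m) := Equiv.ofBijective g
    ((Fintype.bijective_iff_injective_and_card g).2 ⟨hinj, by simp⟩)
  have h1 := (measurePreserving_piCongrLeft (fun _ : Fin (m + m) => D) e).symm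
  have h2 := measurePreserving_sumPiEquivProdPi fun _ : Fin m ⊕ Fin m => D
  have h3 := (measurePreserving_arrowProdEquivProdArrow W W (Fin m)
    (fun _ => D) (fun _ => D)).symm
  exact (h3.comp h2).comp h1

lemma card_mul_exp_le_sum_exp {ι : Type*} [Fintype ι] {x : ι → ℝ} {a : ℝ}
    (h : Fintype.card ι * a ≤ ∑ i, x i) :
    Fintype.card ι * Real.exp a ≤ ∑ i, Real.exp (x i) := by
  have h1 : ∀ i, Real.exp a * (x i - a + 1) ≤ Real.exp (x i) := fun i => by
    calc Real.exp a * (x i - a + 1) ≤ Real.exp a * Real.exp (x i - a) :=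
          mul_le_mul_of_nonneg_left (Real.add_one_le_exp _) (Real.exp_pos a).le
      _ = Real.exp (x i) := by rw [← Real.exp_add]; ring_nf
  have h2 := Finset.sum_le_sum fun i (_ : i ∈ Finset.univ) => h1 i
  rw [← Finset.mul_sum, Finset.sum_add_distrib, Finset.sum_sub_distrib] at h2
  simp only [Finset.sum_const, Finset.card_univ, nsmul_eq_mul, mul_one] at h2
  nlinarith [Real.exp_pos a]

/-- Uniform deviation bound for the average of a loss over all pairings of an i.i.d. sample. -/
theorem le_measure_forall_integral_le_pairing {W T : Type*} [MeasurableSpace W] [Countable T]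
    [Nonempty T] (D : Measure W) [IsProbabilityMeasure D] {ℓ : T → W × W → ℝ} {m : ℕ} (hpos : 0 < m)
    {M A δ : ℝ} (hM0 : 0 < M) (hδ0 : 0 < δ) (hδ1 : δ < 1) (hm : ∀ t, Measurable (ℓ t))
    (h0 : ∀ t z, 0 ≤ ℓ t z) (hM : ∀ t z, ℓ t z ≤ M)
    (hA : ∀ w : Fin m → W × W,
      ∑ ε : Fin m → Bool, ⨆ t, ∑ k, sgn (ε k) * ℓ t (w k) ≤ 2 ^ m * A) :
    ENNReal.ofReal (1 - δ) ≤ (Measure.pi fun _ : Fin (m + m) => D) {S | ∀ t,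
      ∫ z, ℓ t z ∂(D.prod D) ≤
        (∑ σ : Equiv.Perm (Fin (m + m)), ∑ k, ℓ t (pairing σ S k)) /
          (Fintype.card (Equiv.Perm (Fin (m + m))) * m) +
        2 * A / m + M * Real.sqrt (2 * Real.log (1 / δ) / (m + m : ℕ))} := by
  set P := D.prod D with hP
  set N : ℝ := (Fintype.card (Equiv.Perm (Fin (m + m))) : ℝ) with hN
  have hN0 : 0 < N := by rw [hN]; exact_mod_cast Fintype.card_pos
  have hm0 : (0 : ℝ) < m := by exact_mod_cast hpos
  set τ : ℝ := M * Real.sqrt (2 * Real.log (1 / δ) / (m + m : ℕ)) with hτ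
  set s : ℝ := 4 * τ / M ^ 2 with hs
  set G : (Fin m → W × W) → ℝ := supDeviation P ℓ with hG
  set Q : Measure (Fin m → W × W) := Measure.pi fun _ => P with hQ
  set e := ∫ w, G w ∂Q with he
  have hMabs : ∀ t z, |ℓ t z| ≤ M := fun t z => by rw [abs_of_nonneg (h0 t z)]; exact hM t z
  have heA : e ≤ 2 * A := integral_supDeviation_le P hm hMabs hA
  have hGm : Measurable G := measurable_supDeviation P hm
  have hGM : ∀ w, |G w| ≤ m * (M + M) := abs_supDeviation_le P hMabs
  have hlog : 0 < Real.log (1 / δ) := Real.log_pos (by rw [lt_div_iff₀ hδ0]; linarith)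
  have hτ0 : 0 ≤ τ := by positivity
  have hs0 : 0 ≤ s := by positivity
  have hτsq : m * τ ^ 2 = M ^ 2 * Real.log (1 / δ) := by
    rw [hτ, mul_pow, Real.sq_sqrt (by positivity)]
    push_cast
    field_simp
    ring
  have hmgf : ∫ w, Real.exp (s * (G w - e)) ∂Q ≤ δ * Real.exp (s * (m * τ)) := by
    refine (integral_exp_le_of_bounded_differences P s m G hGm hGM
      (abs_supDeviation_update_sub_le P h0 hM)).trans ?_
    have h1 : m * (s ^ 2 * M ^ 2 / 8) - s * (m * τ) = 2 * Real.log δ := by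
      have : m * (s ^ 2 * M ^ 2 / 8) - s * (m * τ) = -2 * (m * τ ^ 2) / M ^ 2 := by
        rw [hs]; field_simp; ring
      rw [this, hτsq, one_div, Real.log_inv]
      field_simp
    rw [one_div, Real.log_inv] at hlog
    calc Real.exp (m * (s ^ 2 * M ^ 2 / 8))
        ≤ Real.exp (Real.log δ + s * (m * τ)) := Real.exp_le_exp.2 (by linarith)
      _ = δ * Real.exp (s * (m * τ)) := by rw [Real.exp_add, Real.exp_log hδ0]
  set H : (Fin (m + m) → W) → ℝ := fun S =>
    ∑ σ : Equiv.Perm (Fin (m + m)), Real.exp (s * (G (pairing σ S) - e)) with hH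
  have hexpm : Measurable fun w => Real.exp (s * (G w - e)) := by fun_prop
  have hexpσ : ∀ σ : Equiv.Perm (Fin (m + m)),
      Measurable fun S : Fin (m + m) → W => Real.exp (s * (G (pairing σ S) - e)) := fun σ =>
    hexpm.comp (measurePreserving_pairing D σ).measurable
  have hHm : Measurable H := Finset.measurable_sum _ fun σ _ => hexpσ σ
  have hexpi : ∀ σ : Equiv.Perm (Fin (m + m)),
      Integrable (fun S : Fin (m + m) → W => Real.exp (s * (G (pairing σ S) - e)))
        (Measure.pi fun _ => D) := fun σ => by
    refine integrable_of_measurable_of_abs_le (C := Real.exp (s * (m * (M + M) - e))) (hexpσ σ)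
      fun S => ?_
    rw [Real.abs_exp]
    exact Real.exp_le_exp.2 (mul_le_mul_of_nonneg_left
      (sub_le_sub_right ((le_abs_self _).trans (hGM _)) _) hs0)
  have hHint : ∫ S, H S ∂(Measure.pi fun _ => D) ≤ δ * (N * Real.exp (s * (m * τ))) := by
    rw [hH, integral_finsetSum _ fun σ _ => hexpi σ]
    simp_rw [integral_comp_of_measurePreserving (measurePreserving_pairing D _) hexpm]
    rw [Finset.sum_const, Finset.card_univ, nsmul_eq_mul]
    nlinarith
  have hbad : (Measure.pi fun _ : Fin (m + m) => D).real
      {S | N * Real.exp (s * (m * τ)) ≤ H S} ≤ δ := by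
    have h1 := mul_meas_ge_le_integral_of_nonneg (μ := Measure.pi fun _ : Fin (m + m) => D) (f := H)
      (ae_of_all _ fun S => Finset.sum_nonneg fun σ _ => (Real.exp_pos _).le)
      (integrable_finsetSum Finset.univ fun σ _ => hexpi σ) (N * Real.exp (s * (m * τ)))
    have h2 : 0 < N * Real.exp (s * (m * τ)) := mul_pos hN0 (Real.exp_pos _)
    refine le_of_mul_le_mul_left (h1.trans (hHint.trans_eq (mul_comm _ _))) h2
  have hbadm : MeasurableSet {S | N * Real.exp (s * (m * τ)) ≤ H S} :=
    measurableSet_le measurable_const hHm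
  have hgood : ENNReal.ofReal (1 - δ) ≤ (Measure.pi fun _ : Fin (m + m) => D)
      {S | N * Real.exp (s * (m * τ)) ≤ H S}ᶜ := by
    rw [← ofReal_measureReal (measure_ne_top _ _)]
    refine ENNReal.ofReal_le_ofReal ?_
    rw [probReal_compl_eq_one_sub hbadm]
    linarith
  refine hgood.trans (measure_mono fun S hS t => ?_)
  by_contra! hlt
  refine hS (card_mul_exp_le_sum_exp ?_)
  have h1 : ∀ σ : Equiv.Perm (Fin (m + m)),
      m * ∫ z, ℓ t z ∂P - ∑ k, ℓ t (pairing σ S k) ≤ G (pairing σ S) := fun σ => by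
    have : ∑ k, (∫ z, ℓ t z ∂P - ℓ t (pairing σ S k)) ≤ G (pairing σ S) :=
      le_ciSup (bddAbove_range_of_abs_le fun t =>
        abs_sum_integral_sub_le P hMabs (pairing σ S) t) t
    simpa [Finset.sum_sub_distrib] using this
  have h2 := Finset.sum_le_sum fun σ (_ : σ ∈ Finset.univ) => h1 σ
  rw [Finset.sum_sub_distrib, Finset.sum_const, Finset.card_univ, nsmul_eq_mul, ← hN] at h2
  have h3 : N * (m * τ + e) ≤ ∑ σ, G (pairing σ S) := by
    refine le_trans ?_ h2
    have h4 := mul_lt_mul_of_pos_left hlt (mul_pos hN0 hm0)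
    have h5 : N * m * ((∑ σ : Equiv.Perm (Fin (m + m)), ∑ k, ℓ t (pairing σ S k)) / (N * m) +
        2 * A / m + τ) = (∑ σ : Equiv.Perm (Fin (m + m)), ∑ k, ℓ t (pairing σ S k)) +
        N * (2 * A) + N * (m * τ) := by
      field_simp
    rw [h5] at h4
    nlinarith
  rw [← Finset.mul_sum, Finset.sum_sub_distrib, Finset.sum_const, Finset.card_univ, nsmul_eq_mul,
    ← hN]
  nlinarith

lemma l2norm_nonneg {p : ℕ} (v : Fin p → ℝ) : 0 ≤ l2norm v := Real.sqrt_nonneg _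

lemma l2norm_sq {p : ℕ} (v : Fin p → ℝ) : l2norm v ^ 2 = ∑ i, v i ^ 2 :=
  Real.sq_sqrt (Finset.sum_nonneg fun _ _ => sq_nonneg _)

lemma ip_le {p : ℕ} (μ v : Fin p → ℝ) : ip μ v ≤ l2norm μ * l2norm v :=
  Real.sum_mul_le_sqrt_mul_sqrt _ _ _

lemma abs_ip_le {p : ℕ} (μ v : Fin p → ℝ) : |ip μ v| ≤ l2norm μ * l2norm v := by
  refine abs_le.2 ⟨?_, ip_le μ v⟩
  have h := ip_le (fun i => -μ i) v
  simp only [ip, l2norm, neg_mul, Finset.sum_neg_distrib, neg_sq] at h ⊢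
  linarith

lemma ip_sum_smul {p m : ℕ} (μ : Fin p → ℝ) (c : Fin m → ℝ) (u : Fin m → Fin p → ℝ) :
    ∑ k, c k * ip μ (u k) = ip μ fun i => ∑ k, c k * u k i := by
  simp only [ip, Finset.mul_sum]
  rw [Finset.sum_comm]
  exact Finset.sum_congr rfl fun i _ => Finset.sum_congr rfl fun k _ => by ring

/-- The Rademacher average of the Euclidean norm of a sum of vectors of norm at most `r`. -/
lemma sum_l2norm_radSum_le {p m : ℕ} {r : ℝ} (hr : 0 ≤ r) (u : Fin m → Fin p → ℝ)
    (hu : ∀ k, l2norm (u k) ≤ r) :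
    ∑ ε : Fin m → Bool, l2norm (fun i => ∑ k, sgn (ε k) * u k i) ≤
      2 ^ m * (r * Real.sqrt m) := by
  refine (sq_le_sq₀ (Finset.sum_nonneg fun _ _ => l2norm_nonneg _) (by positivity)).1 ?_
  refine sq_sum_le_card_mul_sum_sq.trans ?_
  simp only [l2norm_sq]
  rw [Finset.sum_comm]
  have h1 : ∀ i, ∑ ε : Fin m → Bool, (∑ k, sgn (ε k) * u k i) ^ 2 = 2 ^ m * ∑ k, u k i ^ 2 :=
    fun i => by simpa using sum_radSum_sq 0 fun k => u k i
  have h2 : ∑ i, ∑ k, u k i ^ 2 ≤ m * r ^ 2 := by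
    rw [Finset.sum_comm]
    calc ∑ k, ∑ i, u k i ^ 2 ≤ ∑ _k : Fin m, r ^ 2 :=
          Finset.sum_le_sum fun k _ => by
            rw [← l2norm_sq]
            exact pow_le_pow_left₀ (l2norm_nonneg _) (hu k) 2
      _ = m * r ^ 2 := by simp
  simp only [h1, ← Finset.mul_sum, mul_pow, Real.sq_sqrt (Nat.cast_nonneg m)]
  simp only [Finset.card_univ, Fintype.card_pi, Fintype.card_bool, Finset.prod_const,
    Fintype.card_fin, Nat.cast_pow, Nat.cast_ofNat]
  calc (2 : ℝ) ^ m * (2 ^ m * ∑ i, ∑ k, u k i ^ 2) ≤ 2 ^ m * (2 ^ m * (m * r ^ 2)) := by gcongr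
    _ = (2 ^ m) ^ 2 * (r ^ 2 * m) := by ring

section Hinge

variable {X : Type*} {p : ℕ} (K : Fin p → X → X → ℝ)

lemma hinge_nonneg (μ : Fin p → ℝ) (w w' : X × Bool) : 0 ≤ hinge K μ w w' := le_max_left _ _

/-- The label-weighted feature vector of a pair of examples. -/
def signedFeature (z : (X × Bool) × (X × Bool)) (i : Fin p) : ℝ :=
  sgn z.1.2 * sgn z.2.2 * K i z.1.1 z.2.1

lemma hinge_eq (μ : Fin p → ℝ) (z : (X × Bool) × (X × Bool)) :
    hinge K μ z.1 z.2 = max 0 (1 - ip μ (signedFeature K z)) := by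
  simp only [hinge, ip, zmap, signedFeature, Finset.mul_sum]
  congr 2
  exact Finset.sum_congr rfl fun i _ => by ring

lemma l2norm_signedFeature_le {κ : Fin p → ℝ} (hKb : ∀ i x x', |K i x x'| ≤ κ i ^ 2)
    (z : (X × Bool) × (X × Bool)) : l2norm (signedFeature K z) ≤ l2norm fun i => κ i ^ 2 := by
  refine Real.sqrt_le_sqrt (Finset.sum_le_sum fun i _ => ?_)
  refine sq_le_sq' ?_ ?_ <;>
    have h : |signedFeature K z i| ≤ κ i ^ 2 := by
      simpa [signedFeature, abs_mul, abs_sgn] using hKb i z.1.1 z.2.1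
  · exact (abs_le.1 h).1
  · exact (abs_le.1 h).2

lemma measurable_hinge [MeasurableSpace X] (hKm : ∀ i, Measurable fun w : X × X => K i w.1 w.2)
    (μ : Fin p → ℝ) : Measurable fun z : (X × Bool) × (X × Bool) => hinge K μ z.1 z.2 := by
  have hsgn : Measurable sgn := measurable_of_finite _
  have hK : ∀ i, Measurable fun z : (X × Bool) × (X × Bool) => K i z.1.1 z.2.1 := fun i =>
    (hKm i).comp (by fun_prop : Measurable fun z : (X × Bool) × (X × Bool) => (z.1.1, z.2.1))
  simp only [hinge, ip, zmap]
  fun_prop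

lemma continuous_hinge (w w' : X × Bool) : Continuous fun μ : Fin p → ℝ => hinge K μ w w' := by
  simp only [hinge, ip, zmap]
  fun_prop

variable {κ : Fin p → ℝ} {B : ℝ}

lemma abs_ip_signedFeature_le (hKb : ∀ i x x', |K i x x'| ≤ κ i ^ 2) {μ : Fin p → ℝ}
    (hμ : l2norm μ ≤ B) (z : (X × Bool) × (X × Bool)) :
    |ip μ (signedFeature K z)| ≤ (l2norm fun i => κ i ^ 2) * B := by
  rw [mul_comm]
  exact (abs_ip_le _ _).trans (mul_le_mul hμ (l2norm_signedFeature_le K hKb z) (l2norm_nonneg _)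
    ((l2norm_nonneg _).trans hμ))

lemma hinge_le (hKb : ∀ i x x', |K i x x'| ≤ κ i ^ 2) {μ : Fin p → ℝ} (hμ : l2norm μ ≤ B)
    (z : (X × Bool) × (X × Bool)) :
    hinge K μ z.1 z.2 ≤ 1 + (l2norm fun i => κ i ^ 2) * B := by
  have h := abs_ip_signedFeature_le K hKb hμ z
  rw [hinge_eq]
  exact max_le ((abs_nonneg _).trans (h.trans (by linarith))) (by linarith [(abs_le.1 h).1])

/-- The Rademacher average of the hinge losses of predictors in a Euclidean ball. -/
lemma sum_iSup_radSum_hinge_le {T : Type*} [Nonempty T] {θ : T → Fin p → ℝ}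
    (hKb : ∀ i x x', |K i x x'| ≤ κ i ^ 2) (hθ : ∀ t, l2norm (θ t) ≤ B) {m : ℕ}
    (w : Fin m → (X × Bool) × (X × Bool)) :
    ∑ ε : Fin m → Bool, ⨆ t, ∑ k, sgn (ε k) * hinge K (θ t) (w k).1 (w k).2 ≤
      2 ^ m * (B * ((l2norm fun i => κ i ^ 2) * Real.sqrt m)) := by
  have hB : 0 ≤ B := (l2norm_nonneg _).trans (hθ (Classical.arbitrary T))
  have hcontr := sum_iSup_le_of_contraction (C := 1 + (l2norm fun i => κ i ^ 2) * B) (C' := 0)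
    (fun _ : T => 0) (fun k t => ip (θ t) (signedFeature K (w k)))
    (fun k t => hinge K (θ t) (w k).1 (w k).2) (by simp)
    (fun k t => (abs_ip_signedFeature_le K hKb (hθ t) (w k)).trans (by linarith))
    (fun k t => by
      rw [abs_of_nonneg (hinge_nonneg K _ _ _)]
      exact hinge_le K hKb (hθ t) (w k))
    (fun k s t => by
      rw [hinge_eq, hinge_eq, max_comm 0, max_comm 0]
      refine (le_abs_self _).trans ((abs_max_sub_max_le_abs _ _ _).trans_eq ?_)
      rw [abs_sub_comm]
      congr 1
      ring)
  simp only [zero_add] at hcontr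
  refine hcontr.trans ?_
  have hsup : ∀ ε : Fin m → Bool, ⨆ t, ∑ k, sgn (ε k) * ip (θ t) (signedFeature K (w k)) ≤
      B * l2norm fun i => ∑ k, sgn (ε k) * signedFeature K (w k) i := fun ε => ciSup_le fun t => by
    rw [ip_sum_smul]
    exact (ip_le _ _).trans (mul_le_mul_of_nonneg_right (hθ t) (l2norm_nonneg _))
  refine (Finset.sum_le_sum fun ε _ => hsup ε).trans ?_
  rw [← Finset.mul_sum]
  calc _ ≤ B * (2 ^ m * ((l2norm fun i => κ i ^ 2) * Real.sqrt m)) :=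
        mul_le_mul_of_nonneg_left (sum_l2norm_radSum_le (l2norm_nonneg _) _ fun k =>
          l2norm_signedFeature_le K hKb (w k)) hB
    _ = _ := by ring

lemma continuous_trueRisk [MeasurableSpace X]
    (hKm : ∀ i, Measurable fun w : X × X => K i w.1 w.2)
    (hKb : ∀ i x x', |K i x x'| ≤ κ i ^ 2) (D : Measure (X × Bool)) [IsProbabilityMeasure D] :
    Continuous fun μ : {μ : Fin p → ℝ // l2norm μ ≤ B} => trueRisk K D μ := by
  refine continuous_of_dominated (bound := fun _ => 1 + (l2norm fun i => κ i ^ 2) * B)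
    (fun μ => (measurable_hinge K hKm μ).aestronglyMeasurable)
    (fun μ => ae_of_all _ fun z => ?_) (integrable_const _)
    (ae_of_all _ fun z => (continuous_hinge K z.1 z.2).comp continuous_subtype_val)
  rw [Real.norm_eq_abs, abs_of_nonneg (hinge_nonneg K _ _ _)]
  exact hinge_le K hKb μ.2 z

lemma continuous_empRisk {n : ℕ} (S : Fin n → X × Bool) :
    Continuous fun μ : Fin p → ℝ => empRisk K S μ := by
  unfold empRisk
  refine continuous_const.mul (continuous_finsetSum _ fun i _ => continuous_finsetSum _ fun j _ => ?_)
  split_ifs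
  · exact continuous_hinge K _ _
  · exact continuous_const

lemma empRisk_nonneg {n : ℕ} (hn : 1 ≤ n) (S : Fin n → X × Bool) (μ : Fin p → ℝ) :
    0 ≤ empRisk K S μ := by
  have hn' : (0 : ℝ) ≤ (n : ℝ) - 1 := by
    rw [sub_nonneg]
    exact_mod_cast hn
  refine mul_nonneg (by positivity) (Finset.sum_nonneg fun i _ => Finset.sum_nonneg fun j _ => ?_)
  split_ifs
  · exact hinge_nonneg K _ _ _
  · exact le_rfl

/-- The empirical risk is the average over all pairings of the empirical risk on the pairs. -/
lemma sum_pairing_hinge {m : ℕ} (hm : 0 < m) (S : Fin (m + m) → X × Bool) (μ : Fin p → ℝ) :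
    ∑ σ : Equiv.Perm (Fin (m + m)), ∑ k, hinge K μ (pairing σ S k).1 (pairing σ S k).2 =
      Fintype.card (Equiv.Perm (Fin (m + m))) * m * empRisk K S μ := by
  set h : Fin (m + m) → Fin (m + m) → ℝ := fun i j => hinge K μ (S (min i j)) (S (max i j)) with hh
  have hoff : ∑ i, ∑ j, (if i = j then 0 else h i j) =
      2 * ∑ i, ∑ j, if i < j then hinge K μ (S i) (S j) else 0 := by
    have h1 : ∀ i j, (if i = j then 0 else h i j) =
        (if i < j then hinge K μ (S i) (S j) else 0) +
          if j < i then hinge K μ (S j) (S i) else 0 := fun i j => by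
      rcases lt_trichotomy i j with hij | hij | hij
      · simp [hh, hij, hij.ne, hij.not_gt, min_eq_left hij.le, max_eq_right hij.le]
      · simp [hij]
      · simp [hh, hij, hij.ne', hij.not_gt, min_eq_right hij.le, max_eq_left hij.le]
    simp only [h1, Finset.sum_add_distrib]
    rw [Finset.sum_comm (f := fun i j => if j < i then hinge K μ (S j) (S i) else 0)]
    ring
  have hm1 : (1 : ℝ) ≤ m := by exact_mod_cast hm
  have hk : ∀ k : Fin m, ∑ σ : Equiv.Perm (Fin (m + m)),
      hinge K μ (pairing σ S k).1 (pairing σ S k).2 =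
        Fintype.card (Equiv.Perm (Fin (m + m))) * empRisk K S μ := fun k => by
    have h2 := sum_perm_apply_apply h (castAdd_ne_natAdd k k)
    rw [hoff, Fintype.card_fin] at h2
    have hpos : (0 : ℝ) < ((m + m : ℕ) : ℝ) * (((m + m : ℕ) : ℝ) - 1) := by
      push_cast
      exact mul_pos (by linarith) (by linarith)
    rw [empRisk]
    refine mul_left_cancel₀ hpos.ne' (h2.trans ?_)
    have hne : ((m + m : ℕ) : ℝ) - 1 ≠ 0 := right_ne_zero_of_mul hpos.ne'
    have hne' : ((m + m : ℕ) : ℝ) ≠ 0 := left_ne_zero_of_mul hpos.ne'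
    field_simp
  rw [Finset.sum_comm]
  simp only [hk, Finset.sum_const, Finset.card_univ, Fintype.card_fin, nsmul_eq_mul]
  ring

lemma empRisk_zero {m : ℕ} (hm : 0 < m) (S : Fin (m + m) → X × Bool) :
    empRisk K S 0 = 1 := by
  have h1 := sum_pairing_hinge K hm S 0
  have h2 : ∀ z : (X × Bool) × (X × Bool), hinge K 0 z.1 z.2 = 1 := fun z => by simp [hinge, ip]
  have h3 : (0 : ℝ) < Fintype.card (Equiv.Perm (Fin (m + m))) * m := by
    have : 0 < Fintype.card (Equiv.Perm (Fin (m + m))) := Fintype.card_pos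
    positivity
  simp only [h2, Finset.sum_const, Finset.card_univ, Fintype.card_fin, nsmul_eq_mul, mul_one] at h1
  exact (mul_eq_left₀ h3.ne').1 h1.symm

end Hinge

/-- generalization bound for the L2-regularized empirical risk minimizer. -/
theorem stmt9 {X : Type*} [MeasurableSpace X] {p n : ℕ} (hn : 2 ≤ n) (hev : Even n)
    (K : Fin p → X → X → ℝ)
    (hKm : ∀ i, Measurable (fun w : X × X => K i w.1 w.2))
    (κ : Fin p → ℝ) (hκ : ∀ i, 0 < κ i)
    (hKb : ∀ i x x', |K i x x'| ≤ κ i ^ 2)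
    (D : Measure (X × Bool)) [IsProbabilityMeasure D]
    (lam : ℝ) (hlam : 0 < lam) (δ : ℝ) (hδ0 : 0 < δ) (hδ1 : δ < 1) :
    ENNReal.ofReal (1 - δ) ≤
      (Measure.pi fun _ : Fin n => D) {S | ∀ muh : Fin p → ℝ, (∀ i, 0 ≤ muh i) →
        (∀ μ : Fin p → ℝ, (∀ i, 0 ≤ μ i) →
          lam / 2 * l2norm muh ^ 2 + empRisk K S muh ≤
            lam / 2 * l2norm μ ^ 2 + empRisk K S μ) →
        trueRisk K D muh ≤ empRisk K S muh +
          4 * l2norm (fun i => κ i ^ 2) * Real.sqrt (1 / (lam * n)) +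
          (1 + l2norm (fun i => κ i ^ 2) * Real.sqrt (2 / lam)) *
            Real.sqrt (2 * Real.log (1 / δ) / n)} := by
  obtain ⟨m, rfl⟩ := hev
  have hm : 0 < m := by omega
  have hm0 : (0 : ℝ) < m := by exact_mod_cast hm
  set r := l2norm fun i => κ i ^ 2 with hr
  have hr0 : 0 ≤ r := l2norm_nonneg _
  set B := Real.sqrt (2 / lam) with hB
  have hB0 : 0 ≤ B := Real.sqrt_nonneg _
  have : Nonempty {μ : Fin p → ℝ // l2norm μ ≤ B} := ⟨⟨0, by simp [l2norm, hB0]⟩⟩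
  set θ : ℕ → {μ : Fin p → ℝ // l2norm μ ≤ B} := TopologicalSpace.denseSeq _ with hθ
  have hdev := le_measure_forall_integral_le_pairing D
    (ℓ := fun t z => hinge K (θ t) z.1 z.2) hm (M := 1 + r * B) (by positivity) hδ0 hδ1
    (fun t => measurable_hinge K hKm _) (fun t z => hinge_nonneg K _ _ _)
    (fun t z => hinge_le K hKb (θ t).2 z)
    (fun w => sum_iSup_radSum_hinge_le K hKb (fun t => (θ t).2) w)
  have hconst : 2 * (B * (r * Real.sqrt m)) / m =
      4 * r * Real.sqrt (1 / (lam * (m + m : ℕ))) := by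
    have h1 : Real.sqrt (1 / (lam * (m + m : ℕ))) = B / (2 * Real.sqrt m) := by
      rw [Real.sqrt_eq_iff_mul_self_eq (by positivity) (by positivity), div_mul_div_comm,
        mul_mul_mul_comm, Real.mul_self_sqrt (by positivity), Real.mul_self_sqrt hm0.le]
      push_cast
      field_simp
      ring
    rw [h1]
    have h2 : Real.sqrt m ≠ 0 := (Real.sqrt_pos.2 hm0).ne'
    field_simp
    rw [Real.sq_sqrt hm0.le]
    ring
  refine hdev.trans (measure_mono fun S hS muh _ hmin => ?_)
  have hnorm : l2norm muh ≤ B := by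
    have h1 := hmin 0 fun _ => le_rfl
    have h2 : l2norm (0 : Fin p → ℝ) = 0 := by simp [l2norm]
    rw [empRisk_zero K hm, h2] at h1
    refine Real.le_sqrt_of_sq_le ?_
    rw [le_div_iff₀ hlam]
    nlinarith [empRisk_nonneg K (by omega) S muh]
  have hcard : (0 : ℝ) < Fintype.card (Equiv.Perm (Fin (m + m))) := by
    exact_mod_cast Fintype.card_pos
  have hseq : ∀ t, trueRisk K D (θ t) ≤ empRisk K S (θ t) +
      4 * r * Real.sqrt (1 / (lam * (m + m : ℕ))) +
      (1 + r * B) * Real.sqrt (2 * Real.log (1 / δ) / (m + m : ℕ)) := fun t => by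
    have h1 := hS t
    rw [sum_pairing_hinge K hm, mul_div_cancel_left₀ _ (by positivity), hconst] at h1
    exact h1
  have hclosed : IsClosed {μ : {μ : Fin p → ℝ // l2norm μ ≤ B} | trueRisk K D μ ≤
      empRisk K S μ + 4 * r * Real.sqrt (1 / (lam * (m + m : ℕ))) +
      (1 + r * B) * Real.sqrt (2 * Real.log (1 / δ) / (m + m : ℕ))} :=
    isClosed_le (continuous_trueRisk K hKm hKb D)
      ((((continuous_empRisk K S).comp continuous_subtype_val).add continuous_const).add
        continuous_const)
  have hall := hclosed.closure_subset_iff.2 (Set.range_subset_iff.2 hseq)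
  rw [hθ, (TopologicalSpace.denseRange_denseSeq _).closure_range] at hall
  exact hall (Set.mem_univ ⟨muh, hnorm⟩)
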